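/- (Two-sided p-values under global-null PRD.) Suppose all n hypotheses are null, each p_i is uniformly distributed on (0,1), and both the vector (p_1,…,p_n) and the vector (1−p_1,…,1−p_n) satisfy the PRD property. Define the two-sided p-values p^t_i = 2p_i if p_i ≤ 1/2 and p^t_i = 2(1−p_i) if p_i > 1/2. Then the Benjamini–Hochberg procedure at level α applied to (p^t_1,…,p^t_n) satisfies FDR ≤ 2α. -/

import Mathlib

open MeasureTheory Finset

attribute [local instance] Classical.propDecidable

/-- Number of rejections of the Benjamini–Hochberg (step-up) procedure at level `α`
applied to the family of p-values `p` indexed by `ι`: the largest `j` such that the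
`j`-th smallest p-value is at most `α j / n` (equivalently, at least `j` of the
p-values are at most `α j / n`), and `0` if there is no such `j ≥ 1`. -/
noncomputable def bhNumRejections {ι : Type*} [Fintype ι] (α : ℝ) (p : ι → ℝ) : ℕ :=
  Nat.findGreatest
    (fun j => j ≤ (Finset.univ.filter (fun i => p i ≤ α * (j : ℝ) / (Fintype.card ι : ℝ))).card)
    (Fintype.card ι)

/-- False discovery proportion `V / max{R, 1}` of the BH procedure at level `α`
with set of true null hypotheses `N₀`. -/
noncomputable def bhFDP {ι : Type*} [Fintype ι] (α : ℝ) (N₀ : Finset ι) (p : ι → ℝ) : ℝ :=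
  ((N₀.filter (fun i => p i ≤ α * (bhNumRejections α p : ℝ) / (Fintype.card ι : ℝ))).card : ℝ) /
    ((max (bhNumRejections α p) 1 : ℕ) : ℝ)

/-- False discovery rate (expected FDP) of the BH procedure at level `α`. -/
noncomputable def bhFDR {Ω : Type*} [MeasurableSpace Ω] {ι : Type*} [Fintype ι]
    (μ : Measure Ω) (α : ℝ) (N₀ : Finset ι) (p : ι → Ω → ℝ) : ℝ :=
  ∫ ω, bhFDP α N₀ (fun i => p i ω) ∂μ

/-- An increasing subset `D` of the cube `[0,1]^ι`: membership is preserved when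
coordinates increase (while staying at most 1). -/
def IsIncreasingSet {ι : Type*} (D : Set (ι → ℝ)) : Prop :=
  (∀ x ∈ D, ∀ i, x i ∈ Set.Icc (0:ℝ) 1) ∧
    ∀ x ∈ D, ∀ y : ι → ℝ, (∀ i, x i ≤ y i) → (∀ i, y i ≤ 1) → y ∈ D

/-- Positive regression dependence of the random vector `q`: for every increasing set
`D` and every coordinate `i`, the conditional probability `P(q ∈ D ∣ q i ≤ t)` is
non-decreasing in `t ∈ (0,1]` (stated in cross-multiplied form, so that no division
by a possibly vanishing probability occurs). -/
def PRD {Ω : Type*} [MeasurableSpace Ω] {ι : Type*} (μ : Measure Ω) (q : ι → Ω → ℝ) : Prop :=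
  ∀ D : Set (ι → ℝ), IsIncreasingSet D → ∀ i : ι, ∀ s t : ℝ, 0 < s → s ≤ t → t ≤ 1 →
    μ ({ω | (fun j => q j ω) ∈ D} ∩ {ω | q i ω ≤ s}) * μ {ω | q i ω ≤ t} ≤
      μ ({ω | (fun j => q j ω) ∈ D} ∩ {ω | q i ω ≤ t}) * μ {ω | q i ω ≤ s}

/-- PRDN (positive regression dependence within nulls): the subvector of null
p-values `(p i)_{i ∈ N₀}` satisfies PRD. -/
def PRDN {Ω : Type*} [MeasurableSpace Ω] {n : ℕ} (μ : Measure Ω)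
    (N₀ : Finset (Fin n)) (p : Fin n → Ω → ℝ) : Prop :=
  PRD μ (fun (i : {i // i ∈ N₀}) ω => p i.1 ω)

/-- The two-sided p-value induced by a one-sided p-value `u`: `2u` if `u ≤ 1/2` and
`2(1−u)` otherwise. -/
noncomputable def twoSided (u : ℝ) : ℝ := if u ≤ 1 / 2 then 2 * u else 2 * (1 - u)

lemma bhNumRejections_le_card {ι : Type*} [Fintype ι] (α : ℝ) (x : ι → ℝ) :
    bhNumRejections α x ≤ Fintype.card ι :=
  Nat.findGreatest_le _

/-- At least `R` of the p-values lie below the BH threshold. -/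
lemma bhNumRejections_le_count {ι : Type*} [Fintype ι] (α : ℝ) (x : ι → ℝ) :
    bhNumRejections α x ≤ (Finset.univ.filter (fun i =>
      x i ≤ α * (bhNumRejections α x : ℝ) / (Fintype.card ι : ℝ))).card :=
  Nat.findGreatest_spec (P := fun j => j ≤ (Finset.univ.filter
    (fun i => x i ≤ α * (j : ℝ) / (Fintype.card ι : ℝ))).card) (Nat.zero_le _) (Nat.zero_le _)

lemma le_bhNumRejections {ι : Type*} [Fintype ι] {α : ℝ} {x : ι → ℝ} {j : ℕ}
    (hj : j ≤ (Finset.univ.filter (fun i => x i ≤ α * (j : ℝ) / (Fintype.card ι : ℝ))).card) :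
    j ≤ bhNumRejections α x :=
  Nat.le_findGreatest (hj.trans (Finset.card_le_univ _)) hj

/-- If the `j` p-values that are at most `c` satisfy `c ≤ α j / n`, then BH rejects at least `j`
hypotheses. -/
lemma card_filter_le_bhNumRejections {ι : Type*} [Fintype ι] {α c : ℝ} {x : ι → ℝ}
    (hc : c ≤ α * ((Finset.univ.filter (fun i => x i ≤ c)).card : ℝ) / (Fintype.card ι : ℝ)) :
    (Finset.univ.filter (fun i => x i ≤ c)).card ≤ bhNumRejections α x :=
  le_bhNumRejections (Finset.card_le_card fun i hi => by
    simp only [Finset.mem_filter, Finset.mem_univ, true_and] at hi ⊢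
    exact hi.trans hc)

lemma bhNumRejections_anti {ι : Type*} [Fintype ι] (α : ℝ) {x y : ι → ℝ}
    (h : ∀ i, x i ≤ y i) : bhNumRejections α y ≤ bhNumRejections α x :=
  le_bhNumRejections ((bhNumRejections_le_count α y).trans
    (Finset.card_le_card fun i hi => by
      simp only [Finset.mem_filter, Finset.mem_univ, true_and] at hi ⊢
      exact (h i).trans hi))

lemma measurable_bhNumRejections {Ω ι : Type*} [MeasurableSpace Ω] [Fintype ι] (α : ℝ)
    {q : ι → Ω → ℝ} (hq : ∀ i, Measurable (q i)) :
    Measurable fun ω => bhNumRejections α (fun i => q i ω) := by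
  unfold bhNumRejections
  refine measurable_findGreatest fun k _ => ?_
  simp_rw [Finset.card_filter]
  refine measurableSet_le measurable_const (Finset.measurable_sum _ fun i _ => ?_)
  exact Measurable.ite (measurableSet_le (hq i) measurable_const) measurable_const
    measurable_const

/-- BH with all hypotheses null: the false discovery proportion is at most `1`. -/
lemma bhFDP_univ_le_one {ι : Type*} [Fintype ι] {α : ℝ} (hα : 0 ≤ α) (x : ι → ℝ)
    (hx : 1 ≤ bhNumRejections α x) : bhFDP α Finset.univ x ≤ 1 := by
  unfold bhFDP
  refine div_le_one_of_le₀ ?_ (by positivity)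
  rw [max_eq_left hx]
  have h := bhNumRejections_le_count α x
  exact_mod_cast card_filter_le_bhNumRejections (by gcongr)

lemma isIncreasingSet_bhNumRejections_le {ι : Type*} [Fintype ι] (α : ℝ) (k : ℕ) :
    IsIncreasingSet {x : ι → ℝ | (∀ i, x i ∈ Set.Icc (0:ℝ) 1) ∧ bhNumRejections α x ≤ k} :=
  ⟨fun _ hx => hx.1, fun _ hx _ hxy hy =>
    ⟨fun i => ⟨(hx.1 i).1.trans (hxy i), hy i⟩, (bhNumRejections_anti α hxy).trans hx.2⟩⟩

section BenjaminiYekutieli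

variable {Ω ι : Type*} [MeasurableSpace Ω] {μ : Measure Ω} [IsProbabilityMeasure μ] [Fintype ι]
  {q : ι → Ω → ℝ} {α : ℝ}

/-- PRD applied to the event of at most `k` rejections, at two consecutive BH thresholds. -/
lemma PRD.bhNumRejections_le_step (hq01 : ∀ᵐ ω ∂μ, ∀ i, q i ω ∈ Set.Icc (0:ℝ) 1)
    (hqu : ∀ i, ∀ t : ℝ, 0 ≤ t → t ≤ 1 → μ.real {ω | q i ω ≤ t} = t)
    (hPRD : PRD μ q) (hα : 0 < α) (hα1 : α ≤ 1) (i : ι) {k : ℕ} (hk : k < Fintype.card ι) :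
    μ.real ({ω | bhNumRejections α (fun j => q j ω) ≤ k} ∩
        {ω | q i ω ≤ α * k / Fintype.card ι}) / k ≤
      μ.real ({ω | bhNumRejections α (fun j => q j ω) ≤ k} ∩
        {ω | q i ω ≤ α * (k + 1 : ℕ) / Fintype.card ι}) / (k + 1 : ℕ) := by
  rcases Nat.eq_zero_or_pos k with rfl | hk0
  · simp only [Nat.cast_zero, div_zero]
    positivity
  set n := Fintype.card ι
  have hn : (0 : ℝ) < n := by exact_mod_cast (Nat.zero_le k).trans_lt hk
  have hkR : (0 : ℝ) < k := by exact_mod_cast hk0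
  have hkn : ((k + 1 : ℕ) : ℝ) ≤ n := by exact_mod_cast hk
  have hst : α * k / n ≤ α * (k + 1 : ℕ) / n := by gcongr; simp
  have ht1 : α * (k + 1 : ℕ) / n ≤ 1 := by
    rw [div_le_one hn]
    nlinarith
  have h := hPRD _ (isIncreasingSet_bhNumRejections_le α k) i _ _ (by positivity) hst ht1
  have hae : ∀ t : ℝ, μ ({ω | (fun j => q j ω) ∈ {x : ι → ℝ | (∀ i, x i ∈ Set.Icc (0:ℝ) 1) ∧
        bhNumRejections α x ≤ k}} ∩ {ω | q i ω ≤ t}) =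
      μ ({ω | bhNumRejections α (fun j => q j ω) ≤ k} ∩ {ω | q i ω ≤ t}) := fun t => by
    refine measure_congr ?_
    filter_upwards [hq01] with ω hω
    refine propext ⟨fun h => ⟨h.1.2, h.2⟩, fun h => ⟨⟨hω, h.1⟩, h.2⟩⟩
  rw [hae, hae] at h
  have h' := ENNReal.toReal_mono (by finiteness) h
  simp only [ENNReal.toReal_mul] at h'
  simp only [← measureReal_def] at h'
  rw [hqu i _ (by positivity) ht1, hqu i _ (by positivity) (hst.trans ht1)] at h'
  rw [div_le_div_iff₀ hkR (by positivity)]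
  refine le_of_mul_le_mul_right ?_ (div_pos hα hn)
  calc _ = _ := by ring
    _ ≤ _ := h'
    _ = _ := by ring

lemma PRD.sum_bhNumRejections_eq_le (hqm : ∀ i, Measurable (q i))
    (hq01 : ∀ᵐ ω ∂μ, ∀ i, q i ω ∈ Set.Icc (0:ℝ) 1)
    (hqu : ∀ i, ∀ t : ℝ, 0 ≤ t → t ≤ 1 → μ.real {ω | q i ω ≤ t} = t)
    (hPRD : PRD μ q) (hα : 0 < α) (hα1 : α ≤ 1) (i : ι) {m : ℕ} (hm : m ≤ Fintype.card ι) :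
    ∑ k ∈ Finset.range m, μ.real ({ω | bhNumRejections α (fun j => q j ω) = k + 1} ∩
        {ω | q i ω ≤ α * (k + 1 : ℕ) / Fintype.card ι}) / (k + 1 : ℕ) ≤
      μ.real ({ω | bhNumRejections α (fun j => q j ω) ≤ m} ∩
        {ω | q i ω ≤ α * m / Fintype.card ι}) / m := by
  have hR := measurable_bhNumRejections α hqm
  induction m with
  | zero => simp
  | succ m ih =>
    rw [Finset.sum_range_succ]
    have hsplit : μ.real ({ω | bhNumRejections α (fun j => q j ω) ≤ m + 1} ∩
          {ω | q i ω ≤ α * (m + 1 : ℕ) / Fintype.card ι}) =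
        μ.real ({ω | bhNumRejections α (fun j => q j ω) ≤ m} ∩
          {ω | q i ω ≤ α * (m + 1 : ℕ) / Fintype.card ι}) +
        μ.real ({ω | bhNumRejections α (fun j => q j ω) = m + 1} ∩
          {ω | q i ω ≤ α * (m + 1 : ℕ) / Fintype.card ι}) := by
      rw [← measureReal_union]
      · congr 1
        ext ω
        simp only [Set.mem_inter_iff, Set.mem_union, Set.mem_ofPred_eq, Nat.le_succ_iff]
        tauto
      · refine Set.disjoint_left.2 fun ω h h' => ?_
        have h1 := h.1
        have h2 := h'.1
        simp only [Set.mem_ofPred_eq] at h1 h2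
        omega
      · exact (hR (measurableSet_singleton _)).inter (measurableSet_le (hqm i) measurable_const)
    rw [hsplit, add_div]
    gcongr
    exact (ih (by omega)).trans (hPRD.bhNumRejections_le_step hq01 hqu hα hα1 i (by omega))

/-- The Benjamini–Yekutieli theorem under the global null: BH at level `α` rejects
something with probability at most `α`. -/
lemma PRD.measureReal_bhNumRejections_pos_le (hqm : ∀ i, Measurable (q i))
    (hq01 : ∀ᵐ ω ∂μ, ∀ i, q i ω ∈ Set.Icc (0:ℝ) 1)
    (hqu : ∀ i, ∀ t : ℝ, 0 ≤ t → t ≤ 1 → μ.real {ω | q i ω ≤ t} = t)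
    (hPRD : PRD μ q) (hα : 0 < α) (hα1 : α ≤ 1) :
    μ.real {ω | 1 ≤ bhNumRejections α (fun j => q j ω)} ≤ α := by
  have hR := measurable_bhNumRejections α hqm
  set n := Fintype.card ι with hn
  have hsub : {ω | 1 ≤ bhNumRejections α (fun j => q j ω)} ⊆
      ⋃ k ∈ Finset.range n, {ω | bhNumRejections α (fun j => q j ω) = k + 1} := fun ω hω => by
    have h1 : 1 ≤ bhNumRejections α (fun j => q j ω) := hω
    have h2 := bhNumRejections_le_card α (fun j => q j ω)
    simp only [Set.mem_iUnion, Finset.mem_range, Set.mem_ofPred_eq]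
    exact ⟨bhNumRejections α (fun j => q j ω) - 1, by omega, by omega⟩
  have hk : ∀ k : ℕ, μ.real {ω | bhNumRejections α (fun j => q j ω) = k + 1} ≤
      ∑ i, μ.real ({ω | bhNumRejections α (fun j => q j ω) = k + 1} ∩
        {ω | q i ω ≤ α * (k + 1 : ℕ) / n}) / (k + 1 : ℕ) := fun k => by
    set E := {ω | bhNumRejections α (fun j => q j ω) = k + 1}
    have hE : MeasurableSet E := hR (measurableSet_singleton _)
    have hA : ∀ i, MeasurableSet (E ∩ {ω | q i ω ≤ α * (k + 1 : ℕ) / n}) := fun i =>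
      hE.inter (measurableSet_le (hqm i) measurable_const)
    have hint : ∀ i, Integrable ((E ∩ {ω | q i ω ≤ α * (k + 1 : ℕ) / n}).indicator
        (1 : Ω → ℝ)) μ := fun i => (integrable_const 1).indicator (hA i)
    rw [← Finset.sum_div, le_div_iff₀ (by positivity), mul_comm]
    simp_rw [← integral_indicator_one (hA _)]
    rw [← integral_indicator_one hE, ← integral_const_mul,
      ← integral_finsetSum _ fun i _ => hint i]
    refine integral_mono (((integrable_const 1).indicator hE).const_mul _)
      (integrable_finsetSum _ fun i _ => hint i) fun ω => ?_
    by_cases hω : ω ∈ E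
    · have hc := bhNumRejections_le_count α (fun j => q j ω)
      rw [show bhNumRejections α (fun j => q j ω) = k + 1 from hω, Finset.card_filter] at hc
      have hc' : ((k + 1 : ℕ) : ℝ) ≤
          ∑ i, if q i ω ≤ α * (k + 1 : ℕ) / n then (1 : ℝ) else 0 := by exact_mod_cast hc
      simpa [Set.indicator_apply, hω] using hc'
    · simp [hω]
  calc μ.real {ω | 1 ≤ bhNumRejections α (fun j => q j ω)}
      ≤ ∑ k ∈ Finset.range n, μ.real {ω | bhNumRejections α (fun j => q j ω) = k + 1} :=
        (measureReal_mono hsub (measure_ne_top _ _)).trans (measureReal_biUnion_finset_le _ _)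
    _ ≤ ∑ k ∈ Finset.range n, ∑ i, μ.real ({ω | bhNumRejections α (fun j => q j ω) = k + 1} ∩
        {ω | q i ω ≤ α * (k + 1 : ℕ) / n}) / (k + 1 : ℕ) := Finset.sum_le_sum fun k _ => hk k
    _ = ∑ i, ∑ k ∈ Finset.range n, μ.real ({ω | bhNumRejections α (fun j => q j ω) = k + 1} ∩
        {ω | q i ω ≤ α * (k + 1 : ℕ) / n}) / (k + 1 : ℕ) := Finset.sum_comm
    _ ≤ ∑ i : ι, α / n := Finset.sum_le_sum fun i _ => by
        have hn0 : (0 : ℝ) < n := by exact_mod_cast Fintype.card_pos_iff.2 ⟨i⟩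
        refine (hPRD.sum_bhNumRejections_eq_le hqm hq01 hqu hα hα1 i le_rfl).trans ?_
        rw [← hn, mul_div_cancel_right₀ _ hn0.ne']
        gcongr
        exact (measureReal_mono Set.inter_subset_right).trans_eq (hqu i α hα.le hα1)
    _ ≤ α := by
        rw [Finset.sum_const, Finset.card_univ, ← hn, nsmul_eq_mul]
        rcases eq_or_ne (n : ℝ) 0 with h0 | h0
        · simpa [h0] using hα.le
        · exact (mul_div_cancel₀ α h0).le

end BenjaminiYekutieli

/-- If BH at level `α` rejects on the two-sided p-values, it rejects on one of the two
families of one-sided p-values. -/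
lemma bhNumRejections_pos_of_twoSided {ι : Type*} [Fintype ι] {α : ℝ} (hα : 0 ≤ α) {x : ι → ℝ}
    (h : 1 ≤ bhNumRejections α (fun i => twoSided (x i))) :
    1 ≤ bhNumRejections α x ∨ 1 ≤ bhNumRejections α (fun i => 1 - x i) := by
  set k := bhNumRejections α (fun i => twoSided (x i)) with hk
  set n := Fintype.card ι with hn
  set c := α * (k : ℝ) / n / 2 with hc
  set A := Finset.univ.filter (fun i => x i ≤ c) with hA
  set B := Finset.univ.filter (fun i => 1 - x i ≤ c) with hB
  have hcount : k ≤ A.card + B.card := by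
    refine (bhNumRejections_le_count α fun i => twoSided (x i)).trans ((Finset.card_le_card fun i hi => ?_).trans
      (Finset.card_union_le A B))
    simp only [Finset.mem_filter, Finset.mem_univ, true_and, ← hk, ← hn] at hi
    unfold twoSided at hi
    simp only [hA, hB, Finset.mem_union, Finset.mem_filter, Finset.mem_univ, true_and]
    split_ifs at hi
    · left; linarith
    · right; linarith
  have key : ∀ m : ℕ, k ≤ 2 * m → c ≤ α * m / n := fun m hm => by
    have hm' : (k : ℝ) ≤ 2 * m := by exact_mod_cast hm
    calc c = α * (k / 2) / n := by rw [hc]; ring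
      _ ≤ α * m / n := by gcongr; linarith
  rcases (by omega : k ≤ 2 * A.card ∨ k ≤ 2 * B.card) with hm | hm
  · left
    exact (by omega : 1 ≤ A.card).trans (card_filter_le_bhNumRejections (key _ hm))
  · right
    exact (by omega : 1 ≤ B.card).trans (card_filter_le_bhNumRejections (key _ hm))

lemma twoSided_pos {u : ℝ} (h0 : 0 < u) (h1 : u < 1) : 0 < twoSided u := by
  unfold twoSided
  split_ifs <;> linarith

lemma bhFDP_eq_zero {ι : Type*} [Fintype ι] {α : ℝ} {x : ι → ℝ} (hx : ∀ i, 0 < x i)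
    (h : bhNumRejections α x = 0) (N₀ : Finset ι) : bhFDP α N₀ x = 0 := by
  simp [bhFDP, h, Finset.filter_false_of_mem fun i _ => not_le.2 (hx i)]

/-- **Two-sided p-values under global-null PRD.** If all `n` hypotheses are null,
each `p i` is uniform on `(0,1)`, and both `(p₁,…,pₙ)` and `(1−p₁,…,1−pₙ)` satisfy
PRD, then the BH procedure at level `α` applied to the two-sided p-values has
`FDR ≤ 2α`. -/
theorem twosided_global_null_prd
    {Ω : Type*} [MeasurableSpace Ω] (μ : Measure Ω) [IsProbabilityMeasure μ]
    {n : ℕ} (hn : 0 < n) (p : Fin n → Ω → ℝ)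
    (hmeas : ∀ i, Measurable (p i))
    (hunif : ∀ i, Measure.map (p i) μ = volume.restrict (Set.Ioo (0:ℝ) 1))
    (hPRD : PRD μ (fun i ω => p i ω))
    (hPRD' : PRD μ (fun i ω => 1 - p i ω))
    {α : ℝ} (hα : 0 < α) (hα1 : α < 1) :
    bhFDR μ α (Finset.univ : Finset (Fin n)) (fun i ω => twoSided (p i ω)) ≤ 2 * α := by
  have hp01 : ∀ᵐ ω ∂μ, ∀ i, p i ω ∈ Set.Ioo (0:ℝ) 1 := ae_all_iff.2 fun i => by
    refine ae_of_ae_map (p := fun u => u ∈ Set.Ioo (0:ℝ) 1) (hmeas i).aemeasurable ?_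
    rw [hunif i]
    exact ae_restrict_mem measurableSet_Ioo
  have hreal : ∀ i, ∀ S : Set ℝ, MeasurableSet S →
      μ.real (p i ⁻¹' S) = volume.real (S ∩ Set.Ioo (0:ℝ) 1) := fun i S hS => by
    rw [← map_measureReal_apply (hmeas i) hS, hunif i, measureReal_restrict_apply hS]
  have hu : ∀ i, ∀ t : ℝ, 0 ≤ t → t ≤ 1 → μ.real {ω | p i ω ≤ t} = t := fun i t h0 h1 => by
    have hae : (Set.Iic t ∩ Set.Ioo (0:ℝ) 1 : Set ℝ) =ᵐ[volume] Set.Ioc 0 t := by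
      filter_upwards [Ioo_ae_eq_Ioc (μ := volume) (a := (0:ℝ)) (b := 1)] with u hu
      have hu' : u ∈ Set.Ioo (0:ℝ) 1 ↔ u ∈ Set.Ioc (0:ℝ) 1 := iff_of_eq hu
      refine propext ⟨fun h => ⟨h.2.1, h.1⟩, fun h => ⟨h.2, hu'.2 ⟨h.1, h.2.trans h1⟩⟩⟩
    change μ.real (p i ⁻¹' Set.Iic t) = t
    rw [hreal i _ measurableSet_Iic, measureReal_congr hae, Real.volume_real_Ioc_of_le h0, sub_zero]
  have hu' : ∀ i, ∀ t : ℝ, 0 ≤ t → t ≤ 1 → μ.real {ω | 1 - p i ω ≤ t} = t := fun i t h0 h1 => by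
    have hae : (Set.Ici (1 - t) ∩ Set.Ioo (0:ℝ) 1 : Set ℝ) =ᵐ[volume] Set.Ico (1 - t) 1 := by
      filter_upwards [Ioo_ae_eq_Ico (μ := volume) (a := (0:ℝ)) (b := 1)] with u hu
      have hu' : u ∈ Set.Ioo (0:ℝ) 1 ↔ u ∈ Set.Ico (0:ℝ) 1 := iff_of_eq hu
      refine propext ⟨fun h => ⟨h.1, h.2.2⟩,
        fun h => ⟨h.1, hu'.2 ⟨(sub_nonneg.2 h1).trans h.1, h.2⟩⟩⟩
    have hset : {ω | 1 - p i ω ≤ t} = p i ⁻¹' Set.Ici (1 - t) := by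
      ext ω
      simp only [Set.mem_ofPred_eq, Set.mem_preimage, Set.mem_Ici]
      exact sub_le_comm
    rw [hset, hreal i _ measurableSet_Ici, measureReal_congr hae,
      Real.volume_real_Ico_of_le (by linarith), sub_sub_cancel]
  have hmeas' : ∀ i, Measurable fun ω => 1 - p i ω := fun i => (hmeas i).const_sub 1
  have h₁ := hPRD.measureReal_bhNumRejections_pos_le hmeas
    (hp01.mono fun ω h i => Set.Ioo_subset_Icc_self (h i)) hu hα hα1.le
  have h₂ := hPRD'.measureReal_bhNumRejections_pos_le hmeas'
    (hp01.mono fun ω h i => ⟨sub_nonneg.2 (h i).2.le, sub_le_self _ (h i).1.le⟩) hu' hα hα1.le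
  set A := {ω | 1 ≤ bhNumRejections α (fun i => p i ω)} with hA
  set B := {ω | 1 ≤ bhNumRejections α (fun i => 1 - p i ω)} with hB
  have hAm : MeasurableSet A :=
    measurableSet_le measurable_const (measurable_bhNumRejections α hmeas)
  have hBm : MeasurableSet B :=
    measurableSet_le measurable_const (measurable_bhNumRejections α hmeas')
  have hABm := hAm.union hBm
  calc bhFDR μ α Finset.univ (fun i ω => twoSided (p i ω))
      ≤ ∫ ω, (A ∪ B).indicator (1 : Ω → ℝ) ω ∂μ := by
        refine integral_mono_of_nonneg (ae_of_all _ fun ω => ?_)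
          ((integrable_const 1).indicator hABm) ?_
        · simp only [bhFDP, Pi.zero_apply]
          positivity
        · filter_upwards [hp01] with ω hω
          rcases Nat.eq_zero_or_pos (bhNumRejections α fun i => twoSided (p i ω)) with h0 | h1
          · rw [bhFDP_eq_zero (fun i => twoSided_pos (hω i).1 (hω i).2) h0]
            exact Set.indicator_nonneg (fun _ _ => zero_le_one) ω
          · have hmem : ω ∈ A ∪ B := bhNumRejections_pos_of_twoSided hα.le h1
            rw [Set.indicator_of_mem hmem]
            exact bhFDP_univ_le_one hα.le _ h1
    _ = μ.real (A ∪ B) := integral_indicator_one hABm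
    _ ≤ μ.real A + μ.real B := measureReal_union_le A B
    _ ≤ 2 * α := by linarith
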